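/- arXiv:1907.12948 — 4 statements merged into one kernel-verified Lean document; each statement's English description precedes it below -/
import Mathlib

section
/- Let n ≥ 1 be a natural number and α₁,…,αₙ be external numbers, and let λ = α₁α₂⋯αₙ. If some αᵢ is a neutrix, then λ is a neutrix, so R(λ) = ℝ* = max_{1≤i≤n} R(αᵢ). If every αᵢ = aᵢ + Aᵢ is zeroless, then R(λ) = max_{1≤i≤n} R(αᵢ); equivalently, N(λ)/(a₁⋯aₙ) = max_{1≤i≤n} Aᵢ/aᵢ. -/
open scoped Pointwise Classical

noncomputable section

-- Note: `ℝ*` is Mathlib's notation for the hyperreals `Hyperreal`.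

/-- A neutrix: an order-convex additive subgroup of the hyperreals. -/
def IsNeutrix (A : Set ℝ*) : Prop :=
  (0 : ℝ*) ∈ A ∧ (∀ x ∈ A, ∀ y ∈ A, x + y ∈ A) ∧ (∀ x ∈ A, -x ∈ A) ∧
    ∀ x ∈ A, ∀ y ∈ A, ∀ z : ℝ*, x ≤ z → z ≤ y → z ∈ A

/-- The coset `a + A`. -/
def coset (a : ℝ*) (A : Set ℝ*) : Set ℝ* := {x | ∃ u ∈ A, x = a + u}

/-- `α` is an external number: a coset of a neutrix. -/
def IsExt (α : Set ℝ*) : Prop := ∃ a A, IsNeutrix A ∧ α = coset a A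

/-- The neutrix part `N(α)` of an external number, as the set of differences. -/
def Nx (α : Set ℝ*) : Set ℝ* := {d | ∃ x ∈ α, ∃ y ∈ α, d = x - y}

/-- An external number is zeroless if it does not contain `0`. -/
def Zeroless (α : Set ℝ*) : Prop := (0 : ℝ*) ∉ α

/-- Multiplication of external numbers: `αβ = ab + aB + bA + AB`
(independent of the chosen representatives). -/
def emul (α β : Set ℝ*) : Set ℝ* :=
  {z | ∃ a A b B, IsNeutrix A ∧ IsNeutrix B ∧ α = coset a A ∧ β = coset b B ∧
      ∃ u ∈ A, ∃ v ∈ B, ∃ u' ∈ A, ∃ v' ∈ B, z = a * b + a * v + b * u + u' * v'}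

/-- Multiplication of an external number by a hyperreal scalar: `t·α = ta + tA`. -/
def esmul (t : ℝ*) (α : Set ℝ*) : Set ℝ* := (fun x => t * x) '' α

/-- Inverse of a (zeroless) external number: `1/α = 1/a + A/a²`. -/
def einv (α : Set ℝ*) : Set ℝ* :=
  {z | ∃ a A, IsNeutrix A ∧ α = coset a A ∧ ∃ u ∈ A, z = a⁻¹ + u / a ^ 2}

/-- Division of external numbers: `α/β = α · (1/β)`. -/
def ediv (α β : Set ℝ*) : Set ℝ* := emul α (einv β)

/-- The neutrix `⊘` of infinitesimal hyperreals. -/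
def oslash : Set ℝ* := {x | Hyperreal.Infinitesimal x}

/-- Relative uncertainty `R(α)`: `A/a` if `α = a + A` is zeroless,
and all of `ℝ*` if `α` is a neutrix. -/
def RU (α : Set ℝ*) : Set ℝ* :=
  if (0 : ℝ*) ∈ α then Set.univ
  else {z | ∃ a A, IsNeutrix A ∧ α = coset a A ∧ ∃ u ∈ A, z = u / a}

/-- `α` and `β` are nearly opposite: both zeroless and `α/β ⊆ -1 + ⊘`. -/
def NearlyOpposite (α β : Set ℝ*) : Prop :=
  Zeroless α ∧ Zeroless β ∧ ediv α β ⊆ coset (-1) oslash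

/-- Order on external numbers: `α ≤ β` iff `∀ x ∈ α, ∃ y ∈ β, x ≤ y`. -/
def ele (α β : Set ℝ*) : Prop := ∀ x ∈ α, ∃ y ∈ β, x ≤ y

/-- `α` is non-negative: some element of `α` is `≥ 0`. -/
def eNonneg (α : Set ℝ*) : Prop := ∃ x ∈ α, (0 : ℝ*) ≤ x

/-- Absolute value of an external number: `|α| = |a| + A`. -/
def eabs (α : Set ℝ*) : Set ℝ* :=
  {z | ∃ a A, IsNeutrix A ∧ α = coset a A ∧ ∃ u ∈ A, z = |a| + u}

/-- Product of a finite family of external numbers. -/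
def eprod : ∀ {n : ℕ}, (Fin n → Set ℝ*) → Set ℝ*
  | 0, _ => {1}
  | _ + 1, f => emul (f 0) (eprod fun i => f i.succ)

/-- Power of an external number. -/
def epow (α : Set ℝ*) : ℕ → Set ℝ*
  | 0 => {1}
  | k + 1 => emul α (epow α k)

/-- Matrix product over external numbers: `(AB)_{ij} = Σ_k α_{ik}β_{kj}`. -/
def matMul {m n p : ℕ} (M : Matrix (Fin m) (Fin n) (Set ℝ*))
    (N : Matrix (Fin n) (Fin p) (Set ℝ*)) : Matrix (Fin m) (Fin p) (Set ℝ*) :=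
  fun i j => ∑ k, emul (M i k) (N k j)

/-- Entrywise (Minkowski) sum of matrices over external numbers. -/
def matAdd {m n : ℕ} (M N : Matrix (Fin m) (Fin n) (Set ℝ*)) :
    Matrix (Fin m) (Fin n) (Set ℝ*) := fun i j => M i j + N i j

/-- Entrywise scalar multiple of a matrix by an external number. -/
def matSmul {m n : ℕ} (α : Set ℝ*) (M : Matrix (Fin m) (Fin n) (Set ℝ*)) :
    Matrix (Fin m) (Fin n) (Set ℝ*) := fun i j => emul α (M i j)

/-- Entrywise inclusion of matrices over external numbers. -/
def matIncl {m n : ℕ} (M N : Matrix (Fin m) (Fin n) (Set ℝ*)) : Prop :=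
  ∀ i j, M i j ⊆ N i j

/-- Determinant of a square matrix over the external numbers. -/
def detE {n : ℕ} (M : Matrix (Fin n) (Fin n) (Set ℝ*)) : Set ℝ* :=
  ∑ σ : Equiv.Perm (Fin n),
    esmul ((Equiv.Perm.sign σ : ℤ) : ℝ*) (eprod fun i => M i (σ i))

/-- The `(i,j)` minor of a square matrix over the external numbers. -/
def minorE {n : ℕ} (M : Matrix (Fin (n + 1)) (Fin (n + 1)) (Set ℝ*))
    (i j : Fin (n + 1)) : Set ℝ* :=
  detE (M.submatrix i.succAbove j.succAbove)

/-- The near-identity matrix `I_n(N)`: diagonal entries `1 + N`, off-diagonal entries `N`. -/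
def Iun (n : ℕ) (N : Set ℝ*) : Matrix (Fin n) (Fin n) (Set ℝ*) :=
  fun i j => if i = j then coset 1 N else N

/-- A finite family of vectors of external numbers is linearly dependent:
some nontrivial real (hyperreal) linear combination is a neutrix vector. -/
def LinDepE {ι : Type*} [Fintype ι] {n : ℕ} (ξ : ι → Fin n → Set ℝ*) : Prop :=
  ∃ t : ι → ℝ*, (∃ i, t i ≠ 0) ∧ ∃ A : Fin n → Set ℝ*,
    (∀ j, IsNeutrix (A j)) ∧ ∀ j, (∑ i, esmul (t i) (ξ i j)) = A j

/-- The matrix has a zeroless minor of order `k`. -/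
def HasZerolessMinor {m n : ℕ} (M : Matrix (Fin m) (Fin n) (Set ℝ*)) (k : ℕ) : Prop :=
  ∃ (f : Fin k → Fin m) (g : Fin k → Fin n), Function.Injective f ∧ Function.Injective g ∧
    Zeroless (detE fun i j => M (f i) (g j))

/-- The minor rank of `M` is `r`. -/
def minorRankIs {m n : ℕ} (M : Matrix (Fin m) (Fin n) (Set ℝ*)) (r : ℕ) : Prop :=
  HasZerolessMinor M r ∧ ∀ k, HasZerolessMinor M k → k ≤ r

/-- The row rank of `M` is `r`: the maximal cardinality of a linearly
independent set of row vectors of `M` is `r`. -/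
def rowRankIs {m n : ℕ} (M : Matrix (Fin m) (Fin n) (Set ℝ*)) (r : ℕ) : Prop :=
  (∃ s : Finset (Fin m), s.card = r ∧ ¬ LinDepE fun (i : {x // x ∈ s}) j => M i.1 j) ∧
  ∀ s : Finset (Fin m), (¬ LinDepE fun (i : {x // x ∈ s}) j => M i.1 j) → s.card ≤ r

/-- `M` is a reduced matrix: `max_{i,j} |α_{ij}| = 1 + A₀` for some neutrix `A₀ ⊆ ⊘`. -/
def IsReducedMat {m n : ℕ} (M : Matrix (Fin m) (Fin n) (Set ℝ*)) : Prop :=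
  ∃ A₀, IsNeutrix A₀ ∧ A₀ ⊆ oslash ∧ (∃ i j, eabs (M i j) = coset 1 A₀) ∧
    ∀ i j, ele (eabs (M i j)) (coset 1 A₀)

theorem IsNeutrix.mem_of_abs_le {A : Set ℝ*} (hA : IsNeutrix A) {x y : ℝ*} (hx : x ∈ A)
    (h : |y| ≤ |x|) : y ∈ A := by
  have hneg := hA.2.2.1 x hx
  rcases abs_cases x with ⟨hx', _⟩ | ⟨hx', _⟩ <;> rw [hx'] at h
  · exact hA.2.2.2 _ hneg _ hx _ (abs_le.1 h).1 (abs_le.1 h).2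
  · exact hA.2.2.2 _ hx _ hneg _ (by linarith [(abs_le.1 h).1]) (abs_le.1 h).2

theorem IsNeutrix.of_abs {A : Set ℝ*} (h0 : (0 : ℝ*) ∈ A)
    (hadd : ∀ x ∈ A, ∀ y ∈ A, x + y ∈ A) (habs : ∀ x ∈ A, ∀ y : ℝ*, |y| ≤ |x| → y ∈ A) :
    IsNeutrix A := by
  refine ⟨h0, hadd, fun x hx => habs x hx _ (abs_neg x).le, fun x hx y hy z hxz hzy => ?_⟩
  rcases le_max_iff.1 (abs_le_max_abs_abs hxz hzy) with h | h
  · exact habs x hx z h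
  · exact habs y hy z h

theorem IsNeutrix.total {A B : Set ℝ*} (hA : IsNeutrix A) (hB : IsNeutrix B) :
    A ⊆ B ∨ B ⊆ A := by
  by_contra! h
  obtain ⟨x, hxA, hxB⟩ := Set.not_subset.1 h.1
  obtain ⟨y, hyB, hyA⟩ := Set.not_subset.1 h.2
  rcases le_total |x| |y| with h | h
  · exact hxB (hB.mem_of_abs_le hyB h)
  · exact hyA (hA.mem_of_abs_le hxA h)

theorem IsNeutrix.union {A B : Set ℝ*} (hA : IsNeutrix A) (hB : IsNeutrix B) :
    IsNeutrix (A ∪ B) := by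
  rcases hA.total hB with h | h
  · rwa [Set.union_eq_self_of_subset_left h]
  · rwa [Set.union_eq_self_of_subset_right h]

theorem isNeutrix_singleton_zero : IsNeutrix {(0 : ℝ*)} := by
  refine .of_abs rfl ?_ ?_
  · rintro _ rfl _ rfl
    simp
  · rintro _ rfl y hy
    simpa using hy

theorem IsNeutrix.esmul {A : Set ℝ*} (hA : IsNeutrix A) (c : ℝ*) : IsNeutrix (esmul c A) := by
  refine .of_abs ⟨0, hA.1, mul_zero c⟩ ?_ ?_
  · rintro _ ⟨x, hx, rfl⟩ _ ⟨y, hy, rfl⟩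
    exact ⟨x + y, hA.2.1 x hx y hy, mul_add c x y⟩
  · rintro _ ⟨x, hx, rfl⟩ y hy
    rcases eq_or_ne c 0 with rfl | hc
    · exact ⟨0, hA.1, by simpa [eq_comm] using hy⟩
    · refine ⟨y / c, hA.mem_of_abs_le hx ?_, mul_div_cancel₀ y hc⟩
      rw [abs_div, div_le_iff₀ (abs_pos.2 hc), mul_comm, ← abs_mul]
      exact hy

theorem IsNeutrix.image2_mul {A B : Set ℝ*} (hA : IsNeutrix A) (hB : IsNeutrix B) :
    IsNeutrix (Set.image2 (· * ·) A B) := by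
  have key : ∀ u ∈ A, ∀ v ∈ B, ∀ y : ℝ*, |y| ≤ |u| * |v| → y ∈ Set.image2 (· * ·) A B := by
    intro u hu v hv y hy
    rw [← abs_mul] at hy
    obtain ⟨w, hw, rfl⟩ := (hB.esmul u).mem_of_abs_le ⟨v, hv, rfl⟩ hy
    exact ⟨u, hu, w, hw, rfl⟩
  refine .of_abs ⟨0, hA.1, 0, hB.1, mul_zero 0⟩ ?_ ?_
  · rintro _ ⟨u, hu, v, hv, rfl⟩ _ ⟨u', hu', v', hv', rfl⟩
    have habs : ∀ w ∈ B, |w| ∈ B := fun w hw => hB.mem_of_abs_le hw (abs_abs w).le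
    have hV : |v| + |v'| ∈ B := hB.2.1 _ (habs v hv) _ (habs v' hv')
    have hVa : |(|v| + |v'|)| = |v| + |v'| := abs_of_nonneg (by positivity)
    have hsum : |u * v + u' * v'| ≤ |u| * |v| + |u'| * |v'| := by
      simpa only [abs_mul] using abs_add_le (u * v) (u' * v')
    rcases le_total |u| |u'| with h | h
    · refine key u' hu' _ hV _ (hsum.trans ?_)
      rw [hVa, mul_add]
      gcongr
    · refine key u hu _ hV _ (hsum.trans ?_)
      rw [hVa, mul_add]
      gcongr
  · rintro _ ⟨u, hu, v, hv, rfl⟩ y hy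
    exact key u hu v hv y (hy.trans (abs_mul u v).le)

theorem coset_eq_of_mem {a x : ℝ*} {A : Set ℝ*} (hA : IsNeutrix A) (hx : x ∈ coset a A) :
    coset a A = coset x A := by
  obtain ⟨u, hu, rfl⟩ := hx
  ext z
  constructor
  · rintro ⟨w, hw, rfl⟩
    exact ⟨-u + w, hA.2.1 _ (hA.2.2.1 u hu) w hw, by ring⟩
  · rintro ⟨w, hw, rfl⟩
    exact ⟨u + w, hA.2.1 u hu w hw, by ring⟩

theorem self_mem_coset {a : ℝ*} {A : Set ℝ*} (hA : IsNeutrix A) : a ∈ coset a A :=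
  ⟨0, hA.1, (add_zero a).symm⟩

theorem Nx_coset {a : ℝ*} {A : Set ℝ*} (hA : IsNeutrix A) : Nx (coset a A) = A := by
  ext z
  constructor
  · rintro ⟨_, ⟨u, hu, rfl⟩, _, ⟨v, hv, rfl⟩, rfl⟩
    convert hA.2.1 u hu _ (hA.2.2.1 v hv) using 1
    ring
  · exact fun hz => ⟨a + z, ⟨z, hz, rfl⟩, a, self_mem_coset hA, by ring⟩

theorem coset_inj {a b : ℝ*} {A B : Set ℝ*} (hA : IsNeutrix A) (hB : IsNeutrix B)
    (h : coset a A = coset b B) : A = B := by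
  rw [← Nx_coset hA, h, Nx_coset hB]

theorem IsExt.isNeutrix_of_zero_mem {α : Set ℝ*} (hα : IsExt α) (h0 : (0 : ℝ*) ∈ α) :
    IsNeutrix α := by
  obtain ⟨a, A, hA, rfl⟩ := hα
  rw [coset_eq_of_mem hA h0]
  convert hA using 1
  ext z
  simp [coset]

theorem mul_mem_emul {α β : Set ℝ*} (hα : IsExt α) (hβ : IsExt β) {x y : ℝ*} (hx : x ∈ α)
    (hy : y ∈ β) : x * y ∈ emul α β := by
  obtain ⟨a, A, hA, rfl⟩ := hα
  obtain ⟨b, B, hB, rfl⟩ := hβ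
  exact ⟨x, A, y, B, hA, hB, coset_eq_of_mem hA hx, coset_eq_of_mem hB hy, 0, hA.1, 0, hB.1,
    0, hA.1, 0, hB.1, by ring⟩

theorem IsExt.emul {α β : Set ℝ*} (hα : IsExt α) (hβ : IsExt β) : IsExt (emul α β) := by
  obtain ⟨a, A, hA, rfl⟩ := hα
  obtain ⟨b, B, hB, rfl⟩ := hβ
  have hAB := hA.image2_mul hB
  have hM := ((hB.esmul a).union (hA.esmul b)).union hAB
  refine ⟨a * b, _, hM, ?_⟩
  ext z
  constructor
  · rintro ⟨a', A', b', B', hA', hB', h1, h2, u, hu, v, hv, u', hu', v', hv', rfl⟩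
    obtain rfl := coset_inj hA hA' h1
    obtain rfl := coset_inj hB hB' h2
    obtain ⟨s, hs, rfl⟩ : a' ∈ coset a A := h1 ▸ self_mem_coset hA
    obtain ⟨t, ht, rfl⟩ : b' ∈ coset b B := h2 ▸ self_mem_coset hB
    have h3 : a * (t + v) ∈ esmul a B := ⟨_, hB.2.1 t ht v hv, rfl⟩
    have h4 : b * (s + u) ∈ esmul b A := ⟨_, hA.2.1 s hs u hu, rfl⟩
    have h5 : s * (t + v) + (u * t + u' * v') ∈ Set.image2 (· * ·) A B :=
      hAB.2.1 _ ⟨s, hs, _, hB.2.1 t ht v hv, rfl⟩ _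
        (hAB.2.1 _ ⟨u, hu, t, ht, rfl⟩ _ ⟨u', hu', v', hv', rfl⟩)
    exact ⟨_, hM.2.1 _ (hM.2.1 _ (.inl (.inl h3)) _ (.inl (.inr h4))) _ (.inr h5), by ring⟩
  · rintro ⟨_, (⟨v, hv, rfl⟩ | ⟨u, hu, rfl⟩) | ⟨u, hu, v, hv, rfl⟩, rfl⟩
    · exact ⟨a, A, b, B, hA, hB, rfl, rfl, 0, hA.1, v, hv, 0, hA.1, 0, hB.1, by ring⟩
    · exact ⟨a, A, b, B, hA, hB, rfl, rfl, u, hu, 0, hB.1, 0, hA.1, 0, hB.1, by ring⟩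
    · exact ⟨a, A, b, B, hA, hB, rfl, rfl, 0, hA.1, 0, hB.1, u, hu, v, hv, by ring⟩

theorem isExt_eprod {n : ℕ} (α : Fin n → Set ℝ*) (hα : ∀ i, IsExt (α i)) : IsExt (eprod α) := by
  induction n with
  | zero => exact ⟨1, {0}, isNeutrix_singleton_zero, by ext; simp [eprod, coset]⟩
  | succ n ih => exact (hα 0).emul (ih _ fun i => hα i.succ)

theorem prod_mem_eprod {n : ℕ} (α : Fin n → Set ℝ*) (hα : ∀ i, IsExt (α i)) (x : Fin n → ℝ*)
    (hx : ∀ i, x i ∈ α i) : ∏ i, x i ∈ eprod α := by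
  induction n with
  | zero => simp [eprod]
  | succ n ih =>
    rw [Fin.prod_univ_succ]
    exact mul_mem_emul (hα 0) (isExt_eprod _ fun i => hα i.succ) (hx 0)
      (ih _ (fun i => hα i.succ) _ fun i => hx i.succ)

theorem IsExt.nonempty {α : Set ℝ*} (hα : IsExt α) : α.Nonempty := by
  obtain ⟨a, A, hA, rfl⟩ := hα
  exact ⟨a, self_mem_coset hA⟩

theorem zero_mem_eprod {n : ℕ} (α : Fin n → Set ℝ*) (hα : ∀ i, IsExt (α i)) (i : Fin n)
    (hi : (0 : ℝ*) ∈ α i) : (0 : ℝ*) ∈ eprod α := by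
  choose x hx using fun j => (hα j).nonempty
  have h := prod_mem_eprod α hα (Function.update x i 0) fun j => by
    rcases eq_or_ne j i with rfl | hj
    · simpa using hi
    · simpa [hj] using hx j
  rwa [Finset.prod_eq_zero (Finset.mem_univ i) (by simp)] at h

theorem RU_of_zero_mem {α : Set ℝ*} (h : (0 : ℝ*) ∈ α) : RU α = Set.univ := if_pos h

theorem IsNeutrix.two_mul_abs_lt_one {T : Set ℝ*} (hT : IsNeutrix T) (h1 : (1 : ℝ*) ∉ T)
    {t : ℝ*} (ht : t ∈ T) : 2 * |t| < 1 := by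
  by_contra! h
  refine h1 (hT.mem_of_abs_le (hT.2.1 t ht t ht) ?_)
  rwa [abs_one, ← two_mul, abs_mul, abs_two]

theorem IsNeutrix.mul_mem {T : Set ℝ*} (hT : IsNeutrix T) (h1 : (1 : ℝ*) ∉ T) {s t : ℝ*}
    (hs : s ∈ T) (ht : t ∈ T) : s * t ∈ T := by
  refine hT.mem_of_abs_le ht ?_
  rw [abs_mul]
  have := hT.two_mul_abs_lt_one h1 hs
  exact mul_le_of_le_one_left (abs_nonneg t) (by linarith [abs_nonneg s])

/-- `α = a + aT` with `a ≠ 0` and `T` a neutrix not containing `1`: the form of a zeroless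
external number with relative uncertainty `T`. -/
structure HasRelForm (a : ℝ*) (T α : Set ℝ*) : Prop where
  ne_zero : a ≠ 0
  isNeutrix : IsNeutrix T
  one_notMem : (1 : ℝ*) ∉ T
  eq_coset : α = coset a (esmul a T)

theorem HasRelForm.zeroless {a : ℝ*} {T α : Set ℝ*} (h : HasRelForm a T α) : Zeroless α := by
  rw [h.eq_coset]
  rintro ⟨_, ⟨t, ht, rfl⟩, h0⟩
  have h2 : a * (1 + t) = 0 := by linear_combination -h0
  have h3 : -t = 1 := by linear_combination -((mul_eq_zero.1 h2).resolve_left h.ne_zero)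
  exact h.one_notMem (h3 ▸ h.isNeutrix.2.2.1 t ht)

theorem HasRelForm.image_div_eq {a b : ℝ*} {T α B : Set ℝ*} (h : HasRelForm a T α)
    (hB : IsNeutrix B) (hαB : α = coset b B) : (fun x => x / b) '' B = T := by
  have hT := h.isNeutrix
  have hc := h.eq_coset.symm.trans hαB
  obtain rfl := coset_inj (hT.esmul a) hB hc
  obtain ⟨_, ⟨s, hs, rfl⟩, rfl⟩ : b ∈ coset a (esmul a T) := hc ▸ self_mem_coset hB
  have ha := h.ne_zero
  have hs2 := hT.two_mul_abs_lt_one h.one_notMem hs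
  have hs3 := neg_abs_le s
  have hs4 : 0 < 1 + s := by linarith
  have hs5 : a + a * s ≠ 0 := by
    rw [show a + a * s = a * (1 + s) by ring]
    exact mul_ne_zero ha hs4.ne'
  ext z
  constructor
  · rintro ⟨_, ⟨t, ht, rfl⟩, rfl⟩
    refine hT.mem_of_abs_le (hT.2.1 t ht t ht) ?_
    have : a * t / (a + a * s) = t / (1 + s) := by
      rw [show a + a * s = a * (1 + s) by ring, mul_div_mul_left _ _ ha]
    show |a * t / (a + a * s)| ≤ _
    rw [this, abs_div, abs_of_pos hs4, div_le_iff₀ hs4, ← two_mul, abs_mul, abs_two]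
    nlinarith [abs_nonneg t]
  · intro hz
    refine ⟨a * (z + s * z), ⟨_, hT.2.1 z hz _ (hT.mul_mem h.one_notMem hs hz), rfl⟩, ?_⟩
    show a * (z + s * z) / (a + a * s) = z
    rw [div_eq_iff hs5]
    ring

theorem HasRelForm.RU_eq {a : ℝ*} {T α : Set ℝ*} (h : HasRelForm a T α) : RU α = T := by
  rw [RU, if_neg h.zeroless]
  ext z
  constructor
  · rintro ⟨b, B, hB, hα, u, hu, rfl⟩
    exact h.image_div_eq hB hα ▸ ⟨u, hu, rfl⟩
  · exact fun hz => ⟨a, _, h.isNeutrix.esmul a, h.eq_coset, a * z, ⟨z, hz, rfl⟩,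
      (mul_div_cancel_left₀ z h.ne_zero).symm⟩

theorem hasRelForm_coset {a : ℝ*} {A : Set ℝ*} (hA : IsNeutrix A) (h : Zeroless (coset a A)) :
    HasRelForm a (RU (coset a A)) (coset a A) := by
  have ha : a ∉ A := fun ha => h ⟨-a, hA.2.2.1 a ha, by ring⟩
  have ha0 : a ≠ 0 := fun h0 => ha (h0 ▸ hA.1)
  have H : HasRelForm a (esmul a⁻¹ A) (coset a A) := by
    refine ⟨ha0, hA.esmul _, ?_, ?_⟩
    · rintro ⟨u, hu, h1⟩
      have : u = a := by
        have h1' : a⁻¹ * u = 1 := h1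
        field_simp at h1'
        exact h1'
      exact ha (this ▸ hu)
    · simp [esmul, Set.image_image, ha0]
  rwa [H.RU_eq]

theorem HasRelForm.emul {a b : ℝ*} {S T α β : Set ℝ*} (hα : HasRelForm a S α)
    (hβ : HasRelForm b T β) : HasRelForm (a * b) (S ∪ T) (emul α β) := by
  have hS := hα.isNeutrix
  have hT := hβ.isNeutrix
  have hM := hS.union hT
  have h1 : (1 : ℝ*) ∉ S ∪ T := by simp [hα.one_notMem, hβ.one_notMem]
  refine ⟨mul_ne_zero hα.ne_zero hβ.ne_zero, hM, h1, ?_⟩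
  have hA := hS.esmul a
  have hB := hT.esmul b
  ext z
  constructor
  · rintro ⟨a', A', b', B', hA', hB', h3, h4, u, hu, v, hv, u', hu', v', hv', rfl⟩
    have h5 := hα.eq_coset.symm.trans h3
    have h6 := hβ.eq_coset.symm.trans h4
    obtain rfl := coset_inj hA hA' h5
    obtain rfl := coset_inj hB hB' h6
    obtain ⟨_, ⟨s₀, hs₀, rfl⟩, rfl⟩ : a' ∈ coset a (esmul a S) := h5 ▸ self_mem_coset hA
    obtain ⟨_, ⟨t₀, ht₀, rfl⟩, rfl⟩ : b' ∈ coset b (esmul b T) := h6 ▸ self_mem_coset hB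
    obtain ⟨s, hs, rfl⟩ := hu
    obtain ⟨t, ht, rfl⟩ := hv
    obtain ⟨s', hs', rfl⟩ := hu'
    obtain ⟨t', ht', rfl⟩ := hv'
    have p : ∀ x ∈ S, ∀ y ∈ T, x * y ∈ S ∪ T := fun x hx y hy =>
      hM.mul_mem h1 (.inl hx) (.inr hy)
    have q : s₀ + s ∈ S := hS.2.1 _ hs₀ _ hs
    have r : t₀ + t ∈ T := hT.2.1 _ ht₀ _ ht
    have hsum := hM.2.1 _ (hM.2.1 _ (.inl q) _ (.inr r)) _
      (hM.2.1 _ (hM.2.1 _ (p _ hs₀ _ r) _ (p _ hs _ ht₀)) _ (p _ hs' _ ht'))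
    exact ⟨_, ⟨_, hsum, rfl⟩, by ring⟩
  · rintro ⟨_, ⟨x, hx | hx, rfl⟩, rfl⟩
    · exact ⟨a, _, b, _, hA, hB, hα.eq_coset, hβ.eq_coset, a * x, ⟨x, hx, rfl⟩, 0, hB.1,
        0, hA.1, 0, hB.1, by ring⟩
    · exact ⟨a, _, b, _, hA, hB, hα.eq_coset, hβ.eq_coset, 0, hA.1, b * x, ⟨x, hx, rfl⟩,
        0, hA.1, 0, hB.1, by ring⟩

theorem HasRelForm.eprod {n : ℕ} {a : Fin n → ℝ*} {T α : Fin n → Set ℝ*}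
    (h : ∀ i, HasRelForm (a i) (T i) (α i)) :
    HasRelForm (∏ i, a i) ({0} ∪ ⋃ i, T i) (eprod α) := by
  induction n with
  | zero =>
    refine ⟨by simp, by simpa using isNeutrix_singleton_zero, by simp, ?_⟩
    ext
    simp [_root_.eprod, coset, _root_.esmul]
  | succ n ih =>
    have H := (h 0).emul (ih fun i => h i.succ)
    rw [Fin.prod_univ_succ]
    have hU : ({0} ∪ ⋃ i, T i) = T 0 ∪ ({0} ∪ ⋃ i : Fin n, T i.succ) := by
      ext z
      simp only [Set.mem_union, Set.mem_iUnion, Fin.exists_fin_succ]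
      tauto
    rw [hU]
    exact H

theorem exists_forall_subset_of_isNeutrix {ι : Type*} [Finite ι] [Nonempty ι] {T : ι → Set ℝ*}
    (hT : ∀ i, IsNeutrix (T i)) : ∃ i₀, ∀ i, T i ⊆ T i₀ := by
  have hdir : Directed (· ⊆ ·) T := fun i j => by
    rcases (hT i).total (hT j) with h | h
    · exact ⟨j, h, subset_rfl⟩
    · exact ⟨i, subset_rfl, h⟩
  simpa using hdir.finite_le (id : ι → ι)

theorem stmt0 (n : ℕ) (hn : 1 ≤ n) (α : Fin n → Set ℝ*) (hext : ∀ i, IsExt (α i)) :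
    ((∃ i, IsNeutrix (α i)) →
      IsNeutrix (eprod α) ∧ RU (eprod α) = Set.univ ∧
        ∃ i₀, (∀ i, RU (α i) ⊆ RU (α i₀)) ∧ RU (eprod α) = RU (α i₀)) ∧
    ((∀ i, Zeroless (α i)) →
      ∃ i₀, (∀ i, RU (α i) ⊆ RU (α i₀)) ∧ RU (eprod α) = RU (α i₀) ∧
        ∀ (a : Fin n → ℝ*) (A : Fin n → Set ℝ*),
          (∀ i, IsNeutrix (A i) ∧ α i = coset (a i) (A i)) →
            (fun x => x / ∏ i, a i) '' Nx (eprod α) = (fun x => x / a i₀) '' A i₀) := by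
  constructor
  · rintro ⟨i, hi⟩
    have h0 := zero_mem_eprod α hext i hi.1
    have hR := RU_of_zero_mem hi.1
    exact ⟨(isExt_eprod α hext).isNeutrix_of_zero_mem h0, RU_of_zero_mem h0, i,
      fun j => hR ▸ Set.subset_univ _, (RU_of_zero_mem h0).trans hR.symm⟩
  · intro hz
    have : Nonempty (Fin n) := ⟨⟨0, hn⟩⟩
    have hrel : ∀ (a : Fin n → ℝ*) (A : Fin n → Set ℝ*),
        (∀ i, IsNeutrix (A i) ∧ α i = coset (a i) (A i)) →
          ∀ i, HasRelForm (a i) (RU (α i)) (α i) := fun a A h i => by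
      have hi := hz i
      rw [(h i).2] at hi ⊢
      exact hasRelForm_coset (h i).1 hi
    choose c C hC using hext
    have hc := hrel c C hC
    obtain ⟨i₀, hi₀⟩ := exists_forall_subset_of_isNeutrix fun i => (hc i).isNeutrix
    have hU : {0} ∪ ⋃ i, RU (α i) = RU (α i₀) :=
      Set.Subset.antisymm
        (Set.union_subset (Set.singleton_subset_iff.2 (hc i₀).isNeutrix.1) (Set.iUnion_subset hi₀))
        ((Set.subset_iUnion (fun i => RU (α i)) i₀).trans Set.subset_union_right)
    refine ⟨i₀, hi₀, (HasRelForm.eprod hc).RU_eq.trans hU, fun a A h => ?_⟩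
    have H := HasRelForm.eprod (hrel a A h)
    have hN := H.isNeutrix.esmul (∏ i, a i)
    rw [(hrel a A h i₀).image_div_eq (h i₀).1 (h i₀).2, ← hU]
    refine H.image_div_eq ?_ ?_ <;> rw [H.eq_coset, Nx_coset hN]
    exact hN
end
end

section
/- Let α, β, γ be external numbers such that α and β are not nearly opposite (i.e., it is not the case that α and β are both zeroless with α/β ⊆ −1 + ⊘). Then (α + β)γ = αγ + βγ. -/
open scoped Pointwise Classical

noncomputable section

namespace IsNeutrix

variable {A B C : Set ℝ*}

lemma zero_mem (hA : IsNeutrix A) : (0 : ℝ*) ∈ A := hA.1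

lemma add_mem (hA : IsNeutrix A) {x y : ℝ*} (hx : x ∈ A) (hy : y ∈ A) : x + y ∈ A :=
  hA.2.1 x hx y hy

lemma neg_mem (hA : IsNeutrix A) {x : ℝ*} (hx : x ∈ A) : -x ∈ A := hA.2.2.1 x hx

lemma sub_mem (hA : IsNeutrix A) {x y : ℝ*} (hx : x ∈ A) (hy : y ∈ A) : x - y ∈ A :=
  sub_eq_add_neg x y ▸ hA.add_mem hx (hA.neg_mem hy)

lemma mem_of_abs_le_s1 (hA : IsNeutrix A) {x y : ℝ*} (hx : x ∈ A) (h : |y| ≤ |x|) : y ∈ A := by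
  have hx' : |x| ∈ A := by
    rcases abs_choice x with e | e <;> rw [e]
    exacts [hx, hA.neg_mem hx]
  exact hA.2.2.2 _ (hA.neg_mem hx') _ hx' y (abs_le.1 h).1 (abs_le.1 h).2

lemma natCast_mul_mem (hA : IsNeutrix A) (n : ℕ) {x : ℝ*} (hx : x ∈ A) : (n : ℝ*) * x ∈ A := by
  induction n with
  | zero => simpa using hA.zero_mem
  | succ k ih =>
    rw [Nat.cast_succ, add_mul, one_mul]
    exact hA.add_mem ih hx

/-- A neutrix is stable under multiplication by limited numbers. -/
lemma mul_mem_of_abs_le (hA : IsNeutrix A) {n : ℕ} {t x : ℝ*} (ht : |t| ≤ n) (hx : x ∈ A) :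
    t * x ∈ A := by
  refine hA.mem_of_abs_le_s1 (hA.natCast_mul_mem n hx) ?_
  rw [abs_mul, abs_mul, Nat.abs_cast]
  gcongr

lemma add (hA : IsNeutrix A) (hB : IsNeutrix B) : IsNeutrix (A + B) := by
  refine ⟨⟨0, hA.zero_mem, 0, hB.zero_mem, add_zero 0⟩, ?_, ?_, ?_⟩
  · rintro _ ⟨p, hp, q, hq, rfl⟩ _ ⟨p', hp', q', hq', rfl⟩
    exact ⟨p + p', hA.add_mem hp hp', q + q', hB.add_mem hq hq', add_add_add_comm ..⟩
  · rintro _ ⟨p, hp, q, hq, rfl⟩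
    exact ⟨-p, hA.neg_mem hp, -q, hB.neg_mem hq, (neg_add p q).symm⟩
  · have key : ∀ p ∈ A, ∀ q ∈ B, ∀ z : ℝ*, 0 ≤ z → z ≤ p + q → z ∈ A + B := by
      intro p hp q hq z hz hzpq
      rcases le_total z |p| with h | h
      · exact ⟨z, hA.mem_of_abs_le_s1 hp (by rwa [abs_of_nonneg hz]), 0, hB.zero_mem, add_zero z⟩
      · refine ⟨p, hp, z - p, hB.mem_of_abs_le_s1 hq ?_, add_sub_cancel p z⟩
        rw [abs_of_nonneg (by linarith [le_abs_self p])]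
        linarith [le_abs_self q]
    rintro _ ⟨p, hp, q, hq, rfl⟩ _ ⟨p', hp', q', hq', rfl⟩ z h₁ h₂
    rcases le_total 0 z with hz | hz
    · exact key p' hp' q' hq' z hz h₂
    · obtain ⟨r, hr, s, hs, e⟩ := key (-p) (hA.neg_mem hp) (-q) (hB.neg_mem hq) (-z)
        (by linarith) (by simp only at h₁; linarith)
      exact ⟨-r, hA.neg_mem hr, -s, hB.neg_mem hs, by simp only at e ⊢; linarith⟩

lemma subset_add_left (hB : IsNeutrix B) : A ⊆ A + B :=
  fun x hx => ⟨x, hx, 0, hB.zero_mem, add_zero x⟩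

lemma subset_add_right (hA : IsNeutrix A) : B ⊆ A + B :=
  fun x hx => ⟨0, hA.zero_mem, x, hx, zero_add x⟩

/-- The Minkowski product of any set with a neutrix is closed under addition. -/
lemma mul_add_mul_mem (hC : IsNeutrix C) {z w : ℝ*}
    (hz : z ∈ A * C) (hw : w ∈ A * C) : z + w ∈ A * C := by
  have key : ∀ u ∈ A, ∀ v ∈ C, ∀ u' ∈ A, ∀ v' ∈ C, |u| ≤ |u'| → u * v + u' * v' ∈ A * C := by
    intro u hu v hv u' hu' v' hv' h
    rcases eq_or_ne u' 0 with rfl | h0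
    · have : u = 0 := by simpa using h
      subst this
      exact ⟨0, hu, 0, hC.zero_mem, by simp⟩
    · have ht : |u / u'| ≤ (1 : ℕ) := by
        rw [abs_div, Nat.cast_one]
        exact div_le_one_of_le₀ h (abs_nonneg _)
      refine ⟨u', hu', u / u' * v + v', hC.add_mem (hC.mul_mem_of_abs_le ht hv) hv', ?_⟩
      simp only
      field_simp
  obtain ⟨u, hu, v, hv, rfl⟩ := hz
  obtain ⟨u', hu', v', hv', rfl⟩ := hw
  rcases le_total |u| |u'| with h | h
  · exact key u hu v hv u' hu' v' hv' h
  · rw [add_comm]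
    exact key u' hu' v' hv' u hu v hv h

lemma self_mem_coset (hA : IsNeutrix A) (a : ℝ*) : a ∈ coset a A :=
  ⟨0, hA.zero_mem, (add_zero a).symm⟩

lemma coset_eq_of_mem (hA : IsNeutrix A) {a x : ℝ*} (hx : x ∈ coset a A) :
    coset a A = coset x A := by
  obtain ⟨s, hs, rfl⟩ := hx
  ext z
  constructor
  · rintro ⟨u, hu, rfl⟩
    exact ⟨u - s, hA.sub_mem hu hs, by ring⟩
  · rintro ⟨u, hu, rfl⟩
    exact ⟨s + u, hA.add_mem hs hu, by ring⟩

lemma eq_of_coset_eq (hA : IsNeutrix A) (hB : IsNeutrix B) {a b : ℝ*}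
    (h : coset a A = coset b B) : A = B := by
  have ha : a ∈ coset b B := h ▸ hA.self_mem_coset a
  rw [hB.coset_eq_of_mem ha] at h
  ext u
  have hu : a + u ∈ coset a A ↔ a + u ∈ coset a B := by rw [h]
  simpa [coset] using hu

end IsNeutrix

lemma coset_add_coset (a b : ℝ*) (A B : Set ℝ*) :
    coset a A + coset b B = coset (a + b) (A + B) := by
  ext z
  constructor
  · rintro ⟨_, ⟨u, hu, rfl⟩, _, ⟨v, hv, rfl⟩, rfl⟩
    exact ⟨u + v, ⟨u, hu, v, hv, rfl⟩, add_add_add_comm ..⟩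
  · rintro ⟨_, ⟨u, hu, v, hv, rfl⟩, rfl⟩
    exact ⟨a + u, ⟨u, hu, rfl⟩, b + v, ⟨v, hv, rfl⟩, add_add_add_comm ..⟩

/-- The product of external numbers can be computed from any choice of representatives. -/
lemma mem_emul_coset {A C : Set ℝ*} (hA : IsNeutrix A) (hC : IsNeutrix C) (a c z : ℝ*) :
    z ∈ emul (coset a A) (coset c C) ↔
      ∃ v ∈ C, ∃ u ∈ A, ∃ w ∈ A * C, z = a * c + a * v + c * u + w := by
  constructor
  · rintro ⟨a', A', c', C', hA', hC', ha, hc, u, hu, v, hv, u', hu', v', hv', rfl⟩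
    obtain rfl := hA.eq_of_coset_eq hA' ha
    obtain rfl := hC.eq_of_coset_eq hC' hc
    obtain ⟨s, hs, rfl⟩ : a' ∈ coset a A := ha ▸ hA.self_mem_coset a'
    obtain ⟨t, ht, rfl⟩ : c' ∈ coset c C := hc ▸ hC.self_mem_coset c'
    refine ⟨t + v, hC.add_mem ht hv, s + u, hA.add_mem hs hu, s * (t + v) + u * t + u' * v',
      hC.mul_add_mul_mem (hC.mul_add_mul_mem ?_ ?_) ?_, by ring⟩
    exacts [Set.mul_mem_mul hs (hC.add_mem ht hv), Set.mul_mem_mul hu ht, Set.mul_mem_mul hu' hv']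
  · rintro ⟨v, hv, u, hu, _, ⟨u', hu', v', hv', rfl⟩, rfl⟩
    exact ⟨a, A, c, C, hA, hC, rfl, rfl, u, hu, v, hv, u', hu', v', hv', rfl⟩

/-- Distributivity holds as soon as the representatives do not nearly cancel. -/
lemma emul_coset_add_coset {A B C : Set ℝ*} (hA : IsNeutrix A) (hB : IsNeutrix B)
    (hC : IsNeutrix C) (a b c : ℝ*) {n : ℕ} (hn : |b| ≤ n * |a + b|) :
    emul (coset a A + coset b B) (coset c C) =
      emul (coset a A) (coset c C) + emul (coset b B) (coset c C) := by
  ext z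
  rw [coset_add_coset, mem_emul_coset (hA.add hB) hC, Set.mem_add]
  simp only [mem_emul_coset hA hC, mem_emul_coset hB hC]
  constructor
  · rintro ⟨v, hv, _, ⟨p, hp, q, hq, rfl⟩, _, ⟨_, ⟨p', hp', q', hq', rfl⟩, v', hv', rfl⟩, rfl⟩
    exact ⟨_, ⟨v, hv, p, hp, _, Set.mul_mem_mul hp' hv', rfl⟩,
      _, ⟨v, hv, q, hq, _, Set.mul_mem_mul hq' hv', rfl⟩, by ring⟩
  · rintro ⟨_, ⟨v, hv, p, hp, w, hw, rfl⟩, _, ⟨v', hv', q, hq, w', hw', rfl⟩, rfl⟩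
    obtain ⟨t, ht, hbt⟩ : ∃ t : ℝ*, |t| ≤ n ∧ b = (a + b) * t := by
      rcases eq_or_ne (a + b) 0 with h0 | h0
      · exact ⟨0, by simp, by simpa [h0] using hn⟩
      · refine ⟨b / (a + b), ?_, (mul_div_cancel₀ b h0).symm⟩
        rwa [abs_div, div_le_iff₀ (abs_pos.2 h0)]
    refine ⟨v + t * (v' - v), hC.add_mem hv (hC.mul_mem_of_abs_le ht (hC.sub_mem hv' hv)),
      p + q, Set.add_mem_add hp hq, w + w', hC.mul_add_mul_mem
        (Set.mul_subset_mul_right hB.subset_add_left hw)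
        (Set.mul_subset_mul_right hA.subset_add_right hw'), ?_⟩
    linear_combination (v' - v) * hbt

set_option linter.deprecated false

lemma infinitesimal_of_natCast_mul_abs_lt {x : ℝ*} (h : ∀ n : ℕ, (n : ℝ*) * |x| < 1) :
    Hyperreal.Infinitesimal x := by
  rw [Hyperreal.infinitesimal_def]
  intro r hr
  obtain ⟨n, hn⟩ := exists_nat_gt r⁻¹
  have hnr : (1 : ℝ*) < n * (r : ℝ*) :=
    Hyperreal.coe_lt_coe.2 ((inv_lt_iff_one_lt_mul₀ hr).1 hn)
  exact abs_lt.1 (lt_of_mul_lt_mul_left ((h n).trans hnr) n.cast_nonneg)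

/-- Elements of a neutrix are infinitesimal relative to a representative of a zeroless coset. -/
lemma infinitesimal_div_of_zeroless {B : Set ℝ*} (hB : IsNeutrix B) {b u : ℝ*}
    (h : Zeroless (coset b B)) (hu : u ∈ B) : Hyperreal.Infinitesimal (u / b) := by
  have hb : b ≠ 0 := fun hb => h (hb ▸ hB.self_mem_coset b)
  refine infinitesimal_of_natCast_mul_abs_lt fun n => ?_
  rw [abs_div, mul_div_assoc', div_lt_one (abs_pos.2 hb)]
  by_contra! hle
  refine h ⟨-b, hB.neg_mem (hB.mem_of_abs_le_s1 (hB.natCast_mul_mem n hu) ?_),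
    (add_neg_cancel b).symm⟩
  rwa [abs_mul, Nat.abs_cast]

lemma nearlyOpposite_of_infinitesimal {α β : Set ℝ*} (hα : Zeroless α) (hβ : Zeroless β)
    (h : ∀ x ∈ α, ∀ y ∈ β, Hyperreal.Infinitesimal (x / y + 1)) : NearlyOpposite α β := by
  have key : ∀ x ∈ α, ∀ w ∈ einv β, Hyperreal.Infinitesimal (x * w + 1) := by
    rintro x hx _ ⟨b, B, hB, rfl, u, hu, rfl⟩
    have hδ := h x hx b (hB.self_mem_coset b)
    have hε := infinitesimal_div_of_zeroless hB hβ hu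
    have hb : b ≠ 0 := fun hb => hβ (hb ▸ hB.self_mem_coset b)
    have e : x * (b⁻¹ + u / b ^ 2) + 1 = (x / b + 1) + -(u / b) + (x / b + 1) * (u / b) := by
      field_simp
      ring
    rw [e]
    exact (hδ.add hε.neg).add (hδ.mul hε)
  refine ⟨hα, hβ, ?_⟩
  rintro z ⟨a, A, c, C, hA, hC, ha, hc, u, hu, v, hv, u', hu', v', hv', rfl⟩
  have k : ∀ s ∈ A, ∀ t ∈ C, Hyperreal.Infinitesimal ((a + s) * (c + t) + 1) := fun s hs t ht =>
    key _ (ha ▸ ⟨s, hs, rfl⟩) _ (hc ▸ ⟨t, ht, rfl⟩)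
  have hA0 := hA.zero_mem
  have hC0 := hC.zero_mem
  refine ⟨a * c + a * v + c * u + u' * v' + 1, ?_, by ring⟩
  have e : a * c + a * v + c * u + u' * v' + 1 =
      (((a + 0) * (c + v) + 1) + ((a + u) * (c + 0) + 1) + ((a + u') * (c + v') + 1)) +
        -(((a + 0) * (c + v') + 1) + ((a + u') * (c + 0) + 1)) := by ring
  rw [e]
  exact (((k _ hA0 _ hv).add (k _ hu _ hC0)).add (k _ hu' _ hv')).add
    ((k _ hA0 _ hv').add (k _ hu' _ hC0)).neg

/-- External numbers that are not nearly opposite have representatives that do not nearly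
cancel. -/
lemma exists_abs_le_natCast_mul_abs_add {α β : Set ℝ*} (hα : α.Nonempty) (hβ : β.Nonempty)
    (h : ¬ NearlyOpposite α β) : ∃ a ∈ α, ∃ b ∈ β, ∃ n : ℕ, |b| ≤ n * |a + b| := by
  by_cases h0 : (0 : ℝ*) ∈ α
  · obtain ⟨b, hb⟩ := hβ
    exact ⟨0, h0, b, hb, 1, by simp⟩
  by_cases h1 : (0 : ℝ*) ∈ β
  · obtain ⟨a, ha⟩ := hα
    exact ⟨a, ha, 0, h1, 0, by simp⟩
  by_contra! hlt
  refine h (nearlyOpposite_of_infinitesimal h0 h1 fun x hx y hy =>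
    infinitesimal_of_natCast_mul_abs_lt fun n => ?_)
  have hy0 : y ≠ 0 := fun e => h1 (e ▸ hy)
  rw [div_add_one hy0, abs_div, mul_div_assoc', div_lt_one (abs_pos.2 hy0)]
  exact hlt x hx y hy n

theorem stmt1 (α β γ : Set ℝ*) (hα : IsExt α) (hβ : IsExt β) (hγ : IsExt γ)
    (h : ¬ NearlyOpposite α β) :
    emul (α + β) γ = emul α γ + emul β γ := by
  obtain ⟨a₀, A, hA, rfl⟩ := hα
  obtain ⟨b₀, B, hB, rfl⟩ := hβ
  obtain ⟨c, C, hC, rfl⟩ := hγ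
  obtain ⟨a, ha, b, hb, n, hn⟩ := exists_abs_le_natCast_mul_abs_add
    ⟨a₀, hA.self_mem_coset a₀⟩ ⟨b₀, hB.self_mem_coset b₀⟩ h
  rw [hA.coset_eq_of_mem ha, hB.coset_eq_of_mem hb]
  exact emul_coset_add_coset hA hB hC a b c hn
end
end

section
/- Let A be an m×n matrix over 𝔼, B an n×p neutricial matrix (every entry of B is a neutrix), and C a p×q matrix over 𝔼. Then A(BC) = (AB)C. -/
open scoped Pointwise Classical

noncomputable section

theorem IsNeutrix.mem_of_abs_le_s4 {B : Set ℝ*} (hB : IsNeutrix B) {w z : ℝ*} (hw : w ∈ B)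
    (h : |z| ≤ |w|) : z ∈ B := by
  have habs : |w| ∈ B := by
    rcases abs_choice w with h | h <;> rw [h]
    exacts [hw, hB.2.2.1 w hw]
  exact hB.2.2.2 _ (hB.2.2.1 _ habs) _ habs z (abs_le.1 h).1 (abs_le.1 h).2

theorem isNeutrix_zero : IsNeutrix (0 : Set ℝ*) := by
  refine ⟨rfl, ?_, ?_, ?_⟩
  · rintro x rfl y rfl
    simp
  · rintro x rfl
    simp
  · rintro x rfl y rfl z h₁ h₂
    exact le_antisymm h₂ h₁

theorem IsNeutrix.add_s4 {B C : Set ℝ*} (hB : IsNeutrix B) (hC : IsNeutrix C) :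
    IsNeutrix (B + C) := by
  refine ⟨⟨0, hB.1, 0, hC.1, add_zero 0⟩, ?_, ?_, ?_⟩
  · rintro _ ⟨b, hb, c, hc, rfl⟩ _ ⟨b', hb', c', hc', rfl⟩
    exact ⟨b + b', hB.2.1 _ hb _ hb', c + c', hC.2.1 _ hc _ hc', add_add_add_comm b b' c c'⟩
  · rintro _ ⟨b, hb, c, hc, rfl⟩
    exact ⟨-b, hB.2.2.1 _ hb, -c, hC.2.2.1 _ hc, (neg_add b c).symm⟩
  · rintro _ ⟨b, hb, c, hc, rfl⟩ _ ⟨b', hb', c', hc', rfl⟩ z h₁ h₂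
    simp only at h₁ h₂
    by_cases hz : z - c ≤ b'
    · exact ⟨z - c, hB.2.2.2 _ hb _ hb' _ (by linarith) hz, c, hc, sub_add_cancel z c⟩
    · exact ⟨b', hb', z - b', hC.2.2.2 _ hc _ hc' _ (by linarith) (by linarith),
        add_sub_cancel b' z⟩

theorem isNeutrix_sum {ι : Type*} (s : Finset ι) (f : ι → Set ℝ*) (hf : ∀ i, IsNeutrix (f i)) :
    IsNeutrix (∑ i ∈ s, f i) :=
  Finset.sum_induction f IsNeutrix (fun _ _ => IsNeutrix.add_s4) isNeutrix_zero fun i _ => hf i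

/-- Two products with left factors in `S` and right factors in neutrices can be written with a
common left factor, namely the one of larger absolute value. -/
theorem exists_common_left_factor {S B C : Set ℝ*} (hB : IsNeutrix B) (hC : IsNeutrix C)
    {x y v w : ℝ*} (hx : x ∈ S) (hy : y ∈ S) (hv : v ∈ B) (hw : w ∈ C) :
    ∃ z ∈ S, ∃ v' ∈ B, ∃ w' ∈ C, x * v = z * v' ∧ y * w = z * w' := by
  have rescale : ∀ {D : Set ℝ*}, IsNeutrix D → ∀ {s t d : ℝ*}, d ∈ D → |s| ≤ |t| →
      ∃ d' ∈ D, s * d = t * d' := by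
    intro D hD s t d hd hst
    rcases eq_or_ne t 0 with rfl | ht
    · have hs : s = 0 := by simpa using hst
      exact ⟨d, hd, by rw [hs]⟩
    · refine ⟨s / t * d, hD.mem_of_abs_le_s4 hd ?_, by field_simp⟩
      rw [abs_mul, abs_div]
      exact mul_le_of_le_one_left (abs_nonneg d) (div_le_one_of_le₀ hst (abs_nonneg t))
  rcases le_total |x| |y| with h | h
  · obtain ⟨v', hv', e⟩ := rescale hB hv h
    exact ⟨y, hy, v', hv', w, hw, e, rfl⟩
  · obtain ⟨w', hw', e⟩ := rescale hC hw h
    exact ⟨x, hx, v, hv, w', hw', rfl, e⟩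

theorem IsNeutrix.mul_left {S B : Set ℝ*} (hB : IsNeutrix B) (hS : S.Nonempty) :
    IsNeutrix (S * B) := by
  obtain ⟨s, hs⟩ := hS
  refine ⟨⟨s, hs, 0, hB.1, mul_zero s⟩, ?_, ?_, ?_⟩
  · rintro _ ⟨x, hx, v, hv, rfl⟩ _ ⟨y, hy, w, hw, rfl⟩
    obtain ⟨z, hz, v', hv', w', hw', e₁, e₂⟩ := exists_common_left_factor hB hB hx hy hv hw
    exact ⟨z, hz, v' + w', hB.2.1 _ hv' _ hw', by simp only [e₁, e₂, mul_add]⟩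
  · rintro _ ⟨x, hx, v, hv, rfl⟩
    exact ⟨x, hx, -v, hB.2.2.1 _ hv, mul_neg x v⟩
  · rintro _ ⟨x, hx, v, hv, rfl⟩ _ ⟨y, hy, w, hw, rfl⟩ t h₁ h₂
    obtain ⟨z, hz, v', hv', w', hw', e₁, e₂⟩ := exists_common_left_factor hB hB hx hy hv hw
    simp only [e₁, e₂] at h₁ h₂
    rcases lt_trichotomy z 0 with hz0 | rfl | hz0
    · exact ⟨z, hz, t / z, hB.2.2.2 _ hw' _ hv' _ ((le_div_iff_of_neg' hz0).2 h₂)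
        ((div_le_iff_of_neg' hz0).2 h₁), mul_div_cancel₀ t hz0.ne⟩
    · rw [zero_mul] at h₁ h₂
      exact ⟨0, hz, v', hv', by simp only [zero_mul, le_antisymm h₂ h₁]⟩
    · exact ⟨z, hz, t / z, hB.2.2.2 _ hv' _ hw' _ ((le_div_iff₀' hz0).2 h₁)
        ((div_le_iff₀' hz0).2 h₂), mul_div_cancel₀ t hz0.ne'⟩

theorem IsNeutrix.mul_add {B C : Set ℝ*} (hB : IsNeutrix B) (hC : IsNeutrix C) (S : Set ℝ*) :
    S * (B + C) = S * B + S * C := by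
  refine (Set.mul_add_subset S B C).antisymm ?_
  rintro _ ⟨_, ⟨x, hx, v, hv, rfl⟩, _, ⟨y, hy, w, hw, rfl⟩, rfl⟩
  obtain ⟨z, hz, v', hv', w', hw', e₁, e₂⟩ := exists_common_left_factor hB hC hx hy hv hw
  exact ⟨z, hz, v' + w', ⟨v', hv', w', hw', rfl⟩, by simp only [e₁, e₂, _root_.mul_add]⟩

theorem mul_sum_of_isNeutrix {ι : Type*} {S : Set ℝ*} (hS : S.Nonempty) (s : Finset ι)
    (f : ι → Set ℝ*) (hf : ∀ i, IsNeutrix (f i)) :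
    S * ∑ i ∈ s, f i = ∑ i ∈ s, S * f i := by
  induction s using Finset.induction_on with
  | empty => simpa using hS.mul_zero
  | insert i s hi ih =>
    rw [Finset.sum_insert hi, Finset.sum_insert hi, (hf i).mul_add (isNeutrix_sum s f hf), ih]

theorem coset_zero (B : Set ℝ*) : coset 0 B = B := by
  ext x
  simp [coset]

theorem emul_comm (α β : Set ℝ*) : emul α β = emul β α := by
  have key : ∀ α β, emul α β ⊆ emul β α := by
    rintro α β _ ⟨a, A, b, B, hA, hB, hα, hβ, u, hu, v, hv, u', hu', v', hv', rfl⟩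
    exact ⟨b, B, a, A, hB, hA, hβ, hα, v, hv, u, hu, v', hv', u', hu', by ring⟩
  exact (key α β).antisymm (key β α)

/-- The product of an external number and a neutrix is their Minkowski product. -/
theorem emul_eq_mul_of_isNeutrix {α B : Set ℝ*} (hα : IsExt α) (hB : IsNeutrix B) :
    emul α B = α * B := by
  have hN : IsNeutrix (α * B) := hB.mul_left hα.nonempty
  apply Set.Subset.antisymm
  · rintro _ ⟨a, A, b, B', hA, hB', rfl, hβ, u, hu, v, hv, u', hu', v', hv', rfl⟩
    have ha : a ∈ coset a A := ⟨0, hA.1, (add_zero a).symm⟩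
    have hb : b ∈ B := by
      rw [hβ]
      exact ⟨0, hB'.1, (add_zero b).symm⟩
    have mem_B : ∀ t ∈ B', t ∈ B := by
      intro t ht
      have hbt : b + t ∈ B := by
        rw [hβ]
        exact ⟨t, ht, rfl⟩
      simpa using hB.2.1 _ hbt _ (hB.2.2.1 _ hb)
    have mul_mem : ∀ s ∈ A, ∀ t ∈ B, s * t ∈ coset a A * B := by
      intro s hs t ht
      have h := hN.2.1 _ (Set.mul_mem_mul ⟨s, hs, rfl⟩ ht) _
        (Set.mul_mem_mul ha (hB.2.2.1 _ ht))
      convert h using 1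
      ring
    refine hN.2.1 _ (hN.2.1 _ (hN.2.1 _ (Set.mul_mem_mul ha hb) _
      (Set.mul_mem_mul ha (mem_B v hv))) _ ?_) _ (mul_mem u' hu' v' (mem_B v' hv'))
    rw [mul_comm b u]
    exact mul_mem u hu b hb
  · obtain ⟨a, A, hA, rfl⟩ := hα
    rintro _ ⟨_, ⟨u, hu, rfl⟩, v, hv, rfl⟩
    exact ⟨a, A, 0, B, hA, hB, rfl, (coset_zero B).symm, u, hu, v, hv, u, hu, v, hv, by ring⟩

theorem stmt4 {m n p q : ℕ} (A : Matrix (Fin m) (Fin n) (Set ℝ*))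
    (B : Matrix (Fin n) (Fin p) (Set ℝ*)) (C : Matrix (Fin p) (Fin q) (Set ℝ*))
    (hA : ∀ i j, IsExt (A i j)) (hB : ∀ i j, IsNeutrix (B i j))
    (hC : ∀ i j, IsExt (C i j)) :
    matMul A (matMul B C) = matMul (matMul A B) C := by
  funext i j
  have hBC : ∀ k l, IsNeutrix (C l j * B k l) := fun k l => (hB k l).mul_left (hC l j).nonempty
  have hAB : ∀ k l, IsNeutrix (A i k * B k l) := fun k l => (hB k l).mul_left (hA i k).nonempty
  have hl : ∀ k, emul (A i k) (∑ l, emul (B k l) (C l j)) =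
      ∑ l, A i k * (C l j * B k l) := by
    intro k
    simp only [emul_comm (B k _), emul_eq_mul_of_isNeutrix (hC _ j) (hB k _)]
    rw [emul_eq_mul_of_isNeutrix (hA i k) (isNeutrix_sum _ _ (hBC k)),
      mul_sum_of_isNeutrix (hA i k).nonempty _ _ (hBC k)]
  have hr : ∀ l, emul (∑ k, emul (A i k) (B k l)) (C l j) =
      ∑ k, C l j * (A i k * B k l) := by
    intro l
    simp only [emul_eq_mul_of_isNeutrix (hA i _) (hB _ l)]
    rw [emul_comm, emul_eq_mul_of_isNeutrix (hC l j) (isNeutrix_sum _ _ fun k => hAB k l),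
      mul_sum_of_isNeutrix (hC l j).nonempty _ _ fun k => hAB k l]
  simp only [matMul, hl, hr]
  rw [Finset.sum_comm]
  simp only [mul_left_comm]
end
end

section
/- Let A = (α_{ij}) be an n×n matrix over 𝔼 and suppose there exists k ∈ {1,…,n} such that max_{1≤i≤n} R(α_{ik}) ≤ R(α_{ij}) for all 1 ≤ i ≤ n and all j ≠ k. Then the Laplace expansion of the determinant along column k is exact: (−1)^{k+1}α_{1k}Δ_{1,k} + (−1)^{k+2}α_{2k}Δ_{2,k} + ⋯ + (−1)^{k+n}α_{nk}Δ_{n,k} = det(A). -/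
open scoped Pointwise Classical

noncomputable section

/-- The ring of limited hyperreals. -/
def limitedSubring : Subring ℝ* where
  carrier := {x | ∃ n : ℕ, |x| ≤ n}
  one_mem' := ⟨1, by simp⟩
  zero_mem' := ⟨0, by simp⟩
  mul_mem' := by
    rintro x y ⟨m, hm⟩ ⟨n, hn⟩
    refine ⟨m * n, ?_⟩
    rw [abs_mul, Nat.cast_mul]
    gcongr
  add_mem' := by
    rintro x y ⟨m, hm⟩ ⟨n, hn⟩
    refine ⟨m + n, (abs_add_le x y).trans ?_⟩
    rw [Nat.cast_add]
    gcongr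
  neg_mem' := by
    rintro x ⟨n, hn⟩
    exact ⟨n, by rwa [abs_neg]⟩

/-- Neutrices, as the submodules of `ℝ*` over the ring of limited hyperreals. -/
abbrev Neutrix := Submodule limitedSubring ℝ*

/-- The principal neutrix generated by a hyperreal. -/
abbrev principal (a : ℝ*) : Neutrix := Submodule.span limitedSubring {a}

namespace Neutrix

theorem mul_mem_of_abs_le (A : Neutrix) {x t : ℝ*} {n : ℕ} (hx : x ∈ A) (ht : |t| ≤ n) :
    t * x ∈ A :=
  A.smul_mem (⟨t, n, ht⟩ : limitedSubring) hx

theorem mem_of_abs_le (A : Neutrix) {x y : ℝ*} (hx : x ∈ A) (h : |y| ≤ |x|) : y ∈ A := by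
  rcases eq_or_ne x 0 with rfl | hx0
  · simp_all
  · have key : |y / x| ≤ (1 : ℕ) := by
      rw [abs_div, Nat.cast_one]
      exact div_le_one_of_le₀ h (abs_nonneg x)
    simpa [div_mul_cancel₀ y hx0] using A.mul_mem_of_abs_le hx key

theorem isNeutrix (A : Neutrix) : IsNeutrix (A : Set ℝ*) := by
  refine ⟨A.zero_mem, fun x hx y hy => A.add_mem hx hy, fun x hx => A.neg_mem hx,
    fun x hx y hy z hxz hzy => ?_⟩
  rcases le_total 0 z with hz | hz
  · exact A.mem_of_abs_le hy (by rwa [abs_of_nonneg hz, abs_of_nonneg (hz.trans hzy)])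
  · refine A.mem_of_abs_le hx ?_
    rw [abs_of_nonpos hz, abs_of_nonpos (hxz.trans hz)]
    exact neg_le_neg hxz

theorem exists_coe_eq {S : Set ℝ*} (hS : IsNeutrix S) : ∃ A : Neutrix, (A : Set ℝ*) = S := by
  obtain ⟨h0, hadd, hneg, hconv⟩ := hS
  refine ⟨⟨⟨⟨S, fun {a b} ha hb => hadd a ha b hb⟩, h0⟩, ?_⟩, rfl⟩
  rintro ⟨t, n, ht⟩ x hx
  have habs : |x| ∈ S := by
    rcases abs_choice x with h | h <;> rw [h]
    exacts [hx, hneg x hx]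
  have hmul : ∀ m : ℕ, (m : ℝ*) * |x| ∈ S := fun m => by
    induction m with
    | zero => simpa using h0
    | succ m ih => simpa [add_mul] using hadd _ ih _ habs
  have hle : |t * x| ≤ n * |x| := by rw [abs_mul]; gcongr
  exact hconv _ (hneg _ (hmul n)) _ (hmul n) _ (abs_le.mp hle).1 (abs_le.mp hle).2

theorem principal_one : principal 1 = 1 :=
  Submodule.one_eq_span.symm

theorem principal_mul (a b : ℝ*) : principal (a * b) = principal a * principal b := by
  rw [Submodule.span_mul_span, Set.singleton_mul_singleton]

/-- The product of two neutrices consists of products of elements. -/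
theorem mem_mul_iff {A B : Neutrix} {x : ℝ*} :
    x ∈ A * B ↔ ∃ u ∈ A, ∃ v ∈ B, x = u * v := by
  refine ⟨fun hx => ?_, ?_⟩
  · refine Submodule.mul_induction_on hx (fun u hu v hv => ⟨u, hu, v, hv, rfl⟩) ?_
    rintro _ _ ⟨u, hu, v, hv, rfl⟩ ⟨u', hu', v', hv', rfl⟩
    have scale {p q : ℝ*} (h : |p| ≤ |q|) : ∃ t : ℝ*, |t| ≤ (1 : ℕ) ∧ p = t * q := by
      rcases eq_or_ne q 0 with rfl | hq
      · exact ⟨0, by simp, by simpa using h⟩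
      · refine ⟨p / q, ?_, (div_mul_cancel₀ p hq).symm⟩
        rw [abs_div, Nat.cast_one]
        exact div_le_one_of_le₀ h (abs_nonneg q)
    rcases le_total |u| |u'| with h | h
    · obtain ⟨t, ht, rfl⟩ := scale h
      exact ⟨u', hu', _, B.add_mem (B.mul_mem_of_abs_le hv ht) hv', by ring⟩
    · obtain ⟨t, ht, rfl⟩ := scale h
      exact ⟨u, hu, _, B.add_mem hv (B.mul_mem_of_abs_le hv' ht), by ring⟩
  · rintro ⟨u, hu, v, hv, rfl⟩
    exact Submodule.mul_mem_mul hu hv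

theorem sum_le {ι : Type*} {s : Finset ι} {f : ι → Neutrix} {B : Neutrix}
    (h : ∀ i ∈ s, f i ≤ B) : ∑ i ∈ s, f i ≤ B :=
  Finset.sum_induction f (· ≤ B) (fun _ _ ha hb => sup_le ha hb) bot_le h

theorem le_sum {ι : Type*} {s : Finset ι} (f : ι → Neutrix) {i : ι} (hi : i ∈ s) :
    f i ≤ ∑ j ∈ s, f j :=
  Finset.single_le_sum (fun _ _ => bot_le) hi

end Neutrix

theorem mem_coset_iff {a x : ℝ*} {A : Neutrix} : x ∈ coset a A ↔ x - a ∈ A :=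
  ⟨fun ⟨u, hu, hx⟩ => by simpa [hx] using hu, fun h => ⟨x - a, h, by ring⟩⟩

theorem coset_eq_coset_of_sub_mem {a b : ℝ*} {A : Neutrix} (h : b - a ∈ A) :
    coset a A = coset b A := by
  ext x
  rw [mem_coset_iff, mem_coset_iff, ← Submodule.sub_mem_iff_left A h (x := x - a)]
  simp

theorem coset_eq_coset_iff {a b : ℝ*} {A B : Neutrix} :
    coset a A = coset b B ↔ A = B ∧ b - a ∈ A := by
  refine ⟨fun h => ?_, fun ⟨h, hab⟩ => h ▸ coset_eq_coset_of_sub_mem hab⟩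
  have mem (x : ℝ*) : x - a ∈ A ↔ x - b ∈ B := by
    rw [← mem_coset_iff, ← mem_coset_iff, h]
  have hab : b - a ∈ A := (mem b).2 (by simp)
  refine ⟨?_, hab⟩
  ext u
  have := mem (b + u)
  rw [add_sub_cancel_left, add_sub_right_comm, Submodule.add_mem_iff_right A hab] at this
  exact this

theorem sum_coset {ι : Type*} (s : Finset ι) (a : ι → ℝ*) (A : ι → Neutrix) :
    ∑ i ∈ s, coset (a i) (A i) = coset (∑ i ∈ s, a i) (∑ i ∈ s, A i : Neutrix) := by
  have coset_eq (b : ℝ*) (B : Neutrix) : coset b B = {b} + (B : Set ℝ*) := by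
    ext x
    simp [mem_coset_iff, neg_add_eq_sub]
  induction s using Finset.induction_on with
  | empty =>
    ext x
    rw [Finset.sum_empty, Finset.sum_empty, Finset.sum_empty, mem_coset_iff]
    simp
  | insert i s hi ih =>
    rw [Finset.sum_insert hi, Finset.sum_insert hi, Finset.sum_insert hi, ih, coset_eq, coset_eq,
      coset_eq, Submodule.add_eq_sup, Submodule.coe_sup, ← Set.singleton_add_singleton,
      add_add_add_comm]

theorem esmul_coset_of_sq_eq_one {t : ℝ*} (ht : t * t = 1) (a : ℝ*) (A : Neutrix) :
    esmul t (coset a A) = coset (t * a) A := by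
  rcases mul_self_eq_one_iff.mp ht with rfl | rfl
  · simp [esmul]
  · ext x
    simp only [esmul, neg_mul, one_mul, Set.image_neg_eq_neg, Set.mem_neg, mem_coset_iff]
    rw [← A.neg_mem_iff]
    ring_nf

/-- A representative of an external number, together with its neutrix. -/
@[ext]
structure ExtNum where
  center : ℝ*
  err : Neutrix

namespace ExtNum

/-- The external number as a set of hyperreals. -/
def toSet (x : ExtNum) : Set ℝ* := coset x.center x.err

instance : CommMonoid ExtNum where
  one := ⟨1, 0⟩
  mul x y := ⟨x.center * y.center,
    principal x.center * y.err + principal y.center * x.err + x.err * y.err⟩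
  mul_assoc x y z := ExtNum.ext (mul_assoc _ _ _) <| by
    change principal (x.center * y.center) * z.err + principal z.center *
        (principal x.center * y.err + principal y.center * x.err + x.err * y.err) +
        (principal x.center * y.err + principal y.center * x.err + x.err * y.err) * z.err =
      principal x.center *
        (principal y.center * z.err + principal z.center * y.err + y.err * z.err) +
        principal (y.center * z.center) * x.err +
        x.err * (principal y.center * z.err + principal z.center * y.err + y.err * z.err)
    rw [Neutrix.principal_mul, Neutrix.principal_mul]
    ring
  mul_comm x y := ExtNum.ext (mul_comm _ _) <| by
    change principal x.center * y.err + principal y.center * x.err + x.err * y.err =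
      principal y.center * x.err + principal x.center * y.err + y.err * x.err
    ring
  one_mul x := ExtNum.ext (one_mul _) <| by
    change principal 1 * x.err + principal x.center * 0 + 0 * x.err = x.err
    rw [Neutrix.principal_one]
    simp
  mul_one x := ExtNum.ext (mul_one _) <| by
    change principal x.center * 0 + principal 1 * x.err + x.err * 0 = x.err
    rw [Neutrix.principal_one]
    simp

@[simp]
theorem center_one : (1 : ExtNum).center = 1 := rfl

@[simp]
theorem err_one : (1 : ExtNum).err = 0 := rfl

@[simp]
theorem center_mul (x y : ExtNum) : (x * y).center = x.center * y.center := rfl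

theorem err_mul (x y : ExtNum) :
    (x * y).err = principal x.center * y.err + principal y.center * x.err + x.err * y.err := rfl

@[simp]
theorem center_prod {ι : Type*} (s : Finset ι) (x : ι → ExtNum) :
    (∏ i ∈ s, x i).center = ∏ i ∈ s, (x i).center :=
  map_prod (⟨⟨center, center_one⟩, center_mul⟩ : ExtNum →* ℝ*) x s

theorem toSet_mul (x y : ExtNum) : (x * y).toSet = emul x.toSet y.toSet := by
  obtain ⟨a, A⟩ := x
  obtain ⟨b, B⟩ := y
  ext z
  simp only [toSet, mem_coset_iff, center_mul, err_mul]
  constructor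
  · intro hz
    obtain ⟨p, hp, q, hq, hpq⟩ := Submodule.mem_sup.mp hz
    obtain ⟨r, hr, s, hs, rfl⟩ := Submodule.mem_sup.mp hp
    obtain ⟨v, hv, rfl⟩ := Submodule.mem_span_singleton_mul.mp hr
    obtain ⟨u, hu, rfl⟩ := Submodule.mem_span_singleton_mul.mp hs
    obtain ⟨u', hu', v', hv', rfl⟩ := Neutrix.mem_mul_iff.mp hq
    exact ⟨a, A, b, B, A.isNeutrix, B.isNeutrix, rfl, rfl, u, hu, v, hv, u', hu', v', hv',
      by linear_combination -hpq⟩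
  · rintro ⟨a', A', b', B', hA', hB', hA, hB, u, hu, v, hv, u', hu', v', hv', rfl⟩
    obtain ⟨A', rfl⟩ := Neutrix.exists_coe_eq hA'
    obtain ⟨B', rfl⟩ := Neutrix.exists_coe_eq hB'
    obtain ⟨rfl, ha⟩ := coset_eq_coset_iff.mp hA
    obtain ⟨rfl, hb⟩ := coset_eq_coset_iff.mp hB
    have key : a' * b' + a' * v + b' * u + u' * v' - a * b =
        a * (b' - b + v) + b * (a' - a + u) +
          ((a' - a) * (b' - b) + (a' - a) * v + (b' - b) * u + u' * v') := by ring
    rw [key]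
    refine Submodule.add_mem_sup (Submodule.add_mem_sup ?_ ?_) ?_
    · exact Submodule.mem_span_singleton_mul.mpr ⟨_, B.add_mem hb hv, rfl⟩
    · exact Submodule.mem_span_singleton_mul.mpr ⟨_, A.add_mem ha hu, rfl⟩
    · refine add_mem (add_mem (add_mem ?_ ?_) ?_) ?_
      · exact Submodule.mul_mem_mul ha hb
      · exact Submodule.mul_mem_mul ha hv
      · exact mul_comm u (b' - b) ▸ Submodule.mul_mem_mul hu hb
      · exact Submodule.mul_mem_mul hu' hv'

theorem eprod_toSet {n : ℕ} (x : Fin n → ExtNum) :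
    eprod (fun i => (x i).toSet) = (∏ i, x i).toSet := by
  induction n with
  | zero =>
    ext z
    rw [toSet, mem_coset_iff]
    simp [eprod, sub_eq_zero]
  | succ n ih => rw [Fin.prod_univ_succ, toSet_mul, eprod, ih]

theorem detE_toSet {n : ℕ} (m : Matrix (Fin n) (Fin n) ExtNum) :
    detE (fun i j => (m i j).toSet) =
      coset (m.map center).det
        (∑ σ : Equiv.Perm (Fin n), (∏ i, m i (σ i)).err : Neutrix) := by
  have sign_sq (σ : Equiv.Perm (Fin n)) :
      ((Equiv.Perm.sign σ : ℤ) : ℝ*) * ((Equiv.Perm.sign σ : ℤ) : ℝ*) = 1 := by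
    rcases Int.units_eq_one_or (Equiv.Perm.sign σ) with h | h <;> simp [h]
  simp only [detE, eprod_toSet]
  rw [← Matrix.det_transpose, Matrix.det_apply', ← sum_coset]
  refine Finset.sum_congr rfl fun σ _ => ?_
  rw [toSet, esmul_coset_of_sq_eq_one (sign_sq σ), center_prod]
  rfl

theorem exists_toSet_eq {α : Set ℝ*} (hα : IsExt α) :
    ∃ x : ExtNum, x.toSet = α ∧ (0 ∈ α → x.center = 0) := by
  obtain ⟨a, A, hA, rfl⟩ := hα
  obtain ⟨A, rfl⟩ := Neutrix.exists_coe_eq hA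
  by_cases h : (0 : ℝ*) ∈ coset a A
  · exact ⟨⟨0, A⟩, (coset_eq_coset_of_sub_mem (mem_coset_iff.mp h)).symm, fun _ => rfl⟩
  · exact ⟨⟨a, A⟩, rfl, fun h' => absurd h' h⟩

/-- A comparison of relative uncertainties, with denominators cleared. -/
theorem principal_center_mul_err_le {x y : ExtNum} (hy : 0 ∈ y.toSet → y.center = 0)
    (h : RU x.toSet ⊆ RU y.toSet) :
    principal y.center * x.err ≤ principal x.center * y.err := by
  rcases eq_or_ne y.center 0 with hy0 | hy0
  · rw [hy0, principal, Submodule.span_zero_singleton, Submodule.bot_mul]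
    exact bot_le
  have hy' : (0 : ℝ*) ∉ y.toSet := fun h0 => hy0 (hy h0)
  obtain ⟨b, B⟩ := y
  have mem_RU {z : ℝ*} (hz : z ∈ RU (toSet ⟨b, B⟩)) :
      ∃ b' u, u ∈ B ∧ b - b' ∈ B ∧ b' ∉ B ∧ z = u / b' := by
    rw [RU, if_neg hy'] at hz
    obtain ⟨b', B', hB', hB, u, hu, rfl⟩ := hz
    obtain ⟨B', rfl⟩ := Neutrix.exists_coe_eq hB'
    rw [hB, mem_coset_iff, zero_sub, B'.neg_mem_iff] at hy'
    obtain ⟨rfl, hb⟩ := coset_eq_coset_iff.mp hB.symm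
    exact ⟨b', u, hu, hb, hy', rfl⟩
  by_cases hx : (0 : ℝ*) ∈ x.toSet
  · rw [RU, if_pos hx] at h
    obtain ⟨b', u, hu, -, hb', hz⟩ := mem_RU (h (Set.mem_univ 1))
    have hb0 : b' ≠ 0 := fun h0 => hb' (h0 ▸ B.zero_mem)
    rw [eq_div_iff hb0, one_mul] at hz
    exact absurd (hz ▸ hu) hb'
  · intro z hz
    obtain ⟨u, hu, rfl⟩ := Submodule.mem_span_singleton_mul.mp hz
    have hu_mem : u / x.center ∈ RU x.toSet := by
      rw [RU, if_neg hx]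
      exact ⟨x.center, x.err, x.err.isNeutrix, rfl, u, hu, rfl⟩
    obtain ⟨b', v, hv, hb, hb', huv⟩ := mem_RU (h hu_mem)
    have hx0 : x.center ≠ 0 := fun h0 => hx <| by
      rw [toSet, mem_coset_iff, h0, sub_zero]
      exact x.err.zero_mem
    have hb0 : b' ≠ 0 := fun h0 => hb' (h0 ▸ B.zero_mem)
    have hratio : |b / b'| ≤ (2 : ℕ) := by
      have hlt : |b - b'| ≤ |b'| :=
        le_of_not_ge fun hle => hb' (B.mem_of_abs_le hb hle)
      rw [abs_div, div_le_iff₀ (abs_pos.mpr hb0)]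
      have := abs_add_le (b - b') b'
      rw [sub_add_cancel] at this
      push_cast
      linarith
    refine Submodule.mem_span_singleton_mul.mpr
      ⟨b / b' * v, B.mul_mem_of_abs_le hv hratio, ?_⟩
    rw [div_eq_div_iff hx0 hb0] at huv
    change x.center * (b / b' * v) = b * u
    field_simp
    linear_combination -huv

/-- Clearing denominators when `x` is at least as precise, relatively, as the
first factor of a product. -/
theorem principal_center_prod_mul_err_le {n : ℕ} {x : ExtNum} {y : Fin (n + 1) → ExtNum}
    (hy : 0 ∈ (y 0).toSet → (y 0).center = 0) (h : RU x.toSet ⊆ RU (y 0).toSet) :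
    principal (∏ i, y i).center * x.err ≤ principal x.center * (∏ i, y i).err := by
  rw [Fin.prod_univ_succ, center_mul, Neutrix.principal_mul, err_mul]
  set p := ∏ i : Fin n, y i.succ
  calc principal (y 0).center * principal p.center * x.err
      = principal p.center * (principal (y 0).center * x.err) := by ring
    _ ≤ principal p.center * (principal x.center * (y 0).err) :=
        mul_le_mul_right (principal_center_mul_err_le hy h) _
    _ = principal x.center * (principal p.center * (y 0).err) := by ring
    _ ≤ _ := mul_le_mul_right (le_sup_of_le_left le_sup_right) _

end ExtNum

/-- The permutation sending `i` to `k` and acting as `τ` on the complements. -/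
def Fin.extendPerm {n : ℕ} (i k : Fin (n + 1)) (τ : Equiv.Perm (Fin n)) :
    Equiv.Perm (Fin (n + 1)) :=
  (finSuccEquiv' i).trans (τ.optionCongr.trans (finSuccEquiv' k).symm)

@[simp]
theorem Fin.extendPerm_self {n : ℕ} (i k : Fin (n + 1)) (τ : Equiv.Perm (Fin n)) :
    i.extendPerm k τ i = k := by
  simp [extendPerm]

@[simp]
theorem Fin.extendPerm_succAbove {n : ℕ} (i k : Fin (n + 1)) (τ : Equiv.Perm (Fin n))
    (l : Fin n) : i.extendPerm k τ (i.succAbove l) = k.succAbove (τ l) := by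
  simp [extendPerm]

theorem Fin.exists_extendPerm_eq {n : ℕ} (k : Fin (n + 1)) (σ : Equiv.Perm (Fin (n + 1))) :
    ∃ i τ, Fin.extendPerm i k τ = σ := by
  let e := ((finSuccEquiv' (σ.symm k)).symm.trans σ).trans (finSuccEquiv' k)
  have he : e none = none := by simp [e]
  refine ⟨σ.symm k, e.removeNone, ?_⟩
  have hcongr : e.removeNone.optionCongr = e := by
    ext1 o
    cases o with
    | none => simp [he]
    | some a =>
      refine e.removeNone_some (Option.ne_none_iff_exists'.mp fun h => ?_)
      exact Option.some_ne_none a (e.injective (h.trans he.symm))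
  rw [extendPerm, hcongr]
  ext1 j
  simp [e]

/-- The neutrix of the Laplace expansion along column `k` equals that of the determinant. -/
theorem ExtNum.sum_err_laplace {n : ℕ} (m : Matrix (Fin (n + 1)) (Fin (n + 1)) ExtNum)
    (k : Fin (n + 1)) (hm : ∀ i j, 0 ∈ (m i j).toSet → (m i j).center = 0)
    (hk : ∀ i i' j, j ≠ k → RU (m i k).toSet ⊆ RU (m i' j).toSet) :
    ∑ i, (m i k * ⟨((m.map center).submatrix i.succAbove k.succAbove).det,
      ∑ τ : Equiv.Perm (Fin n), (∏ l, m (i.succAbove l) (k.succAbove (τ l))).err⟩ : ExtNum).err =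
      ∑ σ : Equiv.Perm (Fin (n + 1)), (∏ i, m i (σ i)).err := by
  have prod_extendPerm (i : Fin (n + 1)) (τ : Equiv.Perm (Fin n)) :
      ∏ j, m j (i.extendPerm k τ j) =
        m i k * ∏ l, m (i.succAbove l) (k.succAbove (τ l)) := by
    simp [Fin.prod_univ_succAbove _ i]
  apply le_antisymm
  · refine Neutrix.sum_le fun i _ => ?_
    have term_le (τ : Equiv.Perm (Fin n)) :
        (m i k * ∏ l, m (i.succAbove l) (k.succAbove (τ l))).err ≤
          ∑ σ : Equiv.Perm (Fin (n + 1)), (∏ i, m i (σ i)).err := by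
      rw [← prod_extendPerm]
      exact Neutrix.le_sum (fun σ : Equiv.Perm (Fin (n + 1)) => (∏ i, m i (σ i)).err)
        (Finset.mem_univ _)
    have det_mem : principal ((m.map center).submatrix i.succAbove k.succAbove).det ≤
        ∑ τ : Equiv.Perm (Fin n),
          principal (∏ l, m (i.succAbove l) (k.succAbove (τ l))).center := by
      rw [principal, Submodule.span_singleton_le_iff_mem, ← Matrix.det_transpose,
        Matrix.det_apply']
      refine Submodule.sum_mem _ fun τ _ => ?_
      refine Neutrix.le_sum (fun τ : Equiv.Perm (Fin n) =>
        principal (∏ l, m (i.succAbove l) (k.succAbove (τ l))).center) (Finset.mem_univ τ) ?_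
      rw [center_prod]
      rcases Int.units_eq_one_or (Equiv.Perm.sign τ) with h | h <;> simp [h]
    rw [err_mul, Finset.mul_sum, Finset.mul_sum]
    refine sup_le (sup_le (Neutrix.sum_le fun τ _ => ?_) ?_) (Neutrix.sum_le fun τ _ => ?_)
    · exact (le_sup_of_le_left le_sup_left).trans (term_le τ)
    · refine (mul_le_mul_left det_mem _).trans ?_
      rw [Finset.sum_mul]
      exact Neutrix.sum_le fun τ _ => (le_sup_of_le_left le_sup_right).trans (term_le τ)
    · exact le_sup_right.trans (term_le τ)
  · refine Neutrix.sum_le fun σ _ => ?_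
    obtain ⟨i, τ, rfl⟩ := Fin.exists_extendPerm_eq k σ
    rw [prod_extendPerm]
    refine le_trans ?_ (Neutrix.le_sum _ (Finset.mem_univ i))
    have err_le := Neutrix.le_sum (fun τ : Equiv.Perm (Fin n) =>
      (∏ l, m (i.succAbove l) (k.succAbove (τ l))).err) (Finset.mem_univ τ)
    rw [err_mul, err_mul]
    refine sup_le (sup_le ?_ ?_) ?_
    · exact le_sup_of_le_left (le_sup_of_le_left (mul_le_mul_right err_le _))
    · cases n with
      | zero =>
        refine le_sup_of_le_left (le_sup_of_le_right ?_)
        simp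
      | succ n =>
        refine le_sup_of_le_left (le_sup_of_le_left ?_)
        have key := principal_center_prod_mul_err_le
          (y := fun l => m (i.succAbove l) (k.succAbove (τ l))) (hm _ _)
          (hk i (i.succAbove 0) (k.succAbove (τ 0)) (Fin.succAbove_ne k _))
        exact key.trans (mul_le_mul_right err_le _)
    · exact le_sup_of_le_right (mul_le_mul_right err_le _)

theorem stmt7 {n : ℕ} (M : Matrix (Fin (n + 1)) (Fin (n + 1)) (Set ℝ*))
    (hM : ∀ i j, IsExt (M i j)) (k : Fin (n + 1))
    (hk : ∀ i i' j, j ≠ k → RU (M i k) ⊆ RU (M i' j)) :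
    ∑ i : Fin (n + 1), esmul ((-1 : ℝ*) ^ ((i : ℕ) + (k : ℕ))) (emul (M i k) (minorE M i k)) = detE M := by
  choose m hmM hm0 using fun i j => ExtNum.exists_toSet_eq (hM i j)
  obtain rfl : (fun i j => (m i j).toSet) = M := funext₂ hmM
  have sign_sq (e : ℕ) : (-1 : ℝ*) ^ e * (-1) ^ e = 1 := by
    rw [← mul_pow]
    simp
  have minor_eq (i : Fin (n + 1)) : minorE (fun i j => (m i j).toSet) i k =
      ExtNum.toSet ⟨((Matrix.map m ExtNum.center).submatrix i.succAbove k.succAbove).det,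
        ∑ τ : Equiv.Perm (Fin n), (∏ l, m (i.succAbove l) (k.succAbove (τ l))).err⟩ :=
    ExtNum.detE_toSet fun l c => m (i.succAbove l) (k.succAbove c)
  have term_eq (i : Fin (n + 1)) := esmul_coset_of_sq_eq_one (sign_sq (i + k))
  simp only [minor_eq, ← ExtNum.toSet_mul]
  simp only [ExtNum.toSet, term_eq]
  rw [sum_coset, ExtNum.sum_err_laplace m k hm0 hk]
  refine Eq.trans ?_ (ExtNum.detE_toSet m).symm
  rw [Matrix.det_succ_column _ k]
  simp only [ExtNum.center_mul, mul_assoc]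
  rfl
end
end
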